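/- arXiv:2005.13882 — 2 statements merged into one kernel-verified Lean document; each statement's English description precedes it below -/
import Mathlib

section
/- Let n ≥ 2 and m ∈ (n/2, n/2 + 1). There exists a constant C > 0 depending only on n and m with the following property: for every f ∈ L²(m) with ∫_{ℝⁿ} f(x) dx = 0, there exists a vector field g ∈ L²(m−1)ⁿ such that div g = f in the sense of distributions (i.e. ∫_{ℝⁿ} g(x) · ∇v(x) dx = − ∫_{ℝⁿ} f(x) v(x) dx for all smooth compactly supported v) and ‖g‖_{L²(m−1)} ≤ C ‖f‖_{L²(m)}. -/
open MeasureTheory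
open scoped ENNReal RealInnerProductSpace


lemma cs_sq {α : Type*} [MeasurableSpace α] (μ : Measure α) (f g : α → ℝ≥0∞)
    (hf : AEMeasurable f μ) (hg : AEMeasurable g μ) :
    (∫⁻ x, f x * g x ∂μ) ^ 2 ≤ (∫⁻ x, f x ^ 2 ∂μ) * ∫⁻ x, g x ^ 2 ∂μ := by
  have h := ENNReal.lintegral_mul_le_Lp_mul_Lq μ Real.HolderConjugate.two_two hf hg
  simp only [Pi.mul_apply] at h
  calc (∫⁻ x, f x * g x ∂μ) ^ 2 ≤ _ := pow_le_pow_left' h 2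
    _ = _ := by
      rw [mul_pow, ← ENNReal.rpow_natCast, ← ENNReal.rpow_natCast, ← ENNReal.rpow_mul,
        ← ENNReal.rpow_mul]
      norm_num

lemma rpow_fin (b : ℝ) (hb : -1 < b) :
    ∫⁻ t in Set.Ioo (0:ℝ) 1, ENNReal.ofReal (t ^ b) < ∞ := by
  have h : IntegrableOn (fun t : ℝ => t ^ b) (Set.Ioo 0 1) := by
    rw [intervalIntegral.integrableOn_Ioo_rpow_iff zero_lt_one]; exact hb
  exact h.lintegral_lt_top

lemma ker_fin {n : ℕ} (hn : 2 ≤ n) (s : ℝ) (hs : -(n:ℝ) < s) :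
    ∫⁻ u in Metric.ball (0 : EuclideanSpace ℝ (Fin n)) 1, ENNReal.ofReal (‖u‖ ^ s) < ∞ := by
  have : Nontrivial (EuclideanSpace ℝ (Fin n)) := by
    apply Module.nontrivial_of_finrank_pos (R := ℝ)
    simp; omega
  have h : IntegrableOn (fun u : EuclideanSpace ℝ (Fin n) => (fun r : ℝ => r ^ s) ‖u‖) (Metric.ball 0 1) := by
    refine (integrableOn_fun_norm_addHaar volume (f := fun r : ℝ => r ^ s)).2 ?_
    have : IntegrableOn (fun t : ℝ => t ^ (((n - 1 : ℕ) : ℝ) + s)) (Set.Ioo 0 1) := by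
      rw [intervalIntegral.integrableOn_Ioo_rpow_iff zero_lt_one]
      rw [Nat.cast_sub (by omega)]; push_cast; linarith
    refine this.congr_fun ?_ measurableSet_Ioo
    intro t ht
    simp only [finrank_euclideanSpace, Fintype.card_fin, smul_eq_mul]
    rw [Real.rpow_add ht.1, Real.rpow_natCast]
  exact h.lintegral_lt_top

lemma seg_bound {n : ℕ} (v : EuclideanSpace ℝ (Fin n) → ℝ) (hv : ContDiff ℝ 1 v)
    (a : ℝ) (x z : EuclideanSpace ℝ (Fin n)) :
    ‖v x - v z‖ₑ ^ 2 ≤ (∫⁻ t in Set.Ioo (0:ℝ) 1, ENNReal.ofReal (t ^ (-a))) *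
      (‖x - z‖ₑ ^ 2 * ∫⁻ t in Set.Ioo (0:ℝ) 1, ENNReal.ofReal (t ^ a) *
        ‖fderiv ℝ v (z + t • (x - z))‖ₑ ^ 2) := by
  have hc : Continuous (fun t : ℝ => fderiv ℝ v (z + t • (x - z))) :=
    (hv.continuous_fderiv one_ne_zero).comp (by fun_prop)
  have hd : ∀ t : ℝ, HasDerivAt (fun t : ℝ => v (z + t • (x - z)))
      (fderiv ℝ v (z + t • (x - z)) (x - z)) t := by
    intro t
    have h1 : HasDerivAt (fun t : ℝ => z + t • (x - z)) (x - z) t := by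
      simpa using ((hasDerivAt_id t).smul_const (x - z)).const_add z
    exact ((hv.differentiable one_ne_zero _).hasFDerivAt).comp_hasDerivAt t h1
  have hI : v x - v z = ∫ t in (0:ℝ)..1, fderiv ℝ v (z + t • (x - z)) (x - z) := by
    rw [intervalIntegral.integral_eq_sub_of_hasDerivAt (fun t _ => hd t)]
    · simp
    · exact (hc.clm_apply continuous_const).intervalIntegrable _ _
  have hle : ‖v x - v z‖ₑ ≤ ∫⁻ t in Set.Ioo (0:ℝ) 1,
      ENNReal.ofReal (t ^ (-a/2)) * (ENNReal.ofReal (t ^ (a/2)) *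
        (‖x - z‖ₑ * ‖fderiv ℝ v (z + t • (x - z))‖ₑ)) := by
    rw [hI, intervalIntegral.integral_of_le zero_le_one, integral_Ioc_eq_integral_Ioo]
    refine (enorm_integral_le_lintegral_enorm _).trans ?_
    refine setLIntegral_mono' measurableSet_Ioo ?_
    intro t ht
    rw [← mul_assoc, ← ENNReal.ofReal_mul (by have := ht.1; positivity), ← Real.rpow_add ht.1]
    have : -a / 2 + a / 2 = 0 := by ring
    rw [this, Real.rpow_zero, ENNReal.ofReal_one, one_mul, mul_comm]
    exact ContinuousLinearMap.le_opENorm _ _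
  have hsq : ∀ b : ℝ, ∀ t ∈ Set.Ioo (0:ℝ) 1,
      ENNReal.ofReal (t ^ (b/2)) ^ 2 = ENNReal.ofReal (t ^ b) := by
    intro b t ht
    rw [← ENNReal.ofReal_pow (by have := ht.1; positivity), ← Real.rpow_natCast,
      ← Real.rpow_mul ht.1.le]
    norm_num
  have hm : Measurable (fun t : ℝ => ‖fderiv ℝ v (z + t • (x - z))‖ₑ) :=
    hc.enorm.measurable
  refine (pow_le_pow_left' hle 2).trans ((cs_sq _ _ _ ?_ ?_).trans ?_)
  · exact (by fun_prop : Measurable _).aemeasurable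
  · exact (by fun_prop : Measurable _).aemeasurable
  apply le_of_eq
  congr 1
  · exact setLIntegral_congr_fun measurableSet_Ioo (fun t ht => hsq (-a) t ht)
  · rw [← lintegral_const_mul _ (by fun_prop)]
    refine setLIntegral_congr_fun measurableSet_Ioo (fun t ht => ?_)
    simp only [mul_pow, hsq a t ht]
    ring

lemma dil {n : ℕ} (H : EuclideanSpace ℝ (Fin n) → ℝ≥0∞) (hH : Measurable H) (t : ℝ) (ht : 0 < t) :
    ∫⁻ u, H (t • u) = ENNReal.ofReal (t ^ (-(n:ℝ))) * ∫⁻ u, H u := by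
  have h := Measure.map_addHaar_smul (volume : Measure (EuclideanSpace ℝ (Fin n))) ht.ne'
  rw [← lintegral_map (f := H) (g := fun u => t • u) hH (by fun_prop), h, lintegral_smul_measure]
  simp only [finrank_euclideanSpace, Fintype.card_fin, smul_eq_mul]
  congr 2
  rw [abs_of_pos (by positivity), Real.rpow_neg ht.le, Real.rpow_natCast]

lemma cov {n : ℕ} (s : ℝ) (G : EuclideanSpace ℝ (Fin n) → ℝ≥0∞) (hG : Measurable G)
    (z : EuclideanSpace ℝ (Fin n)) (t : ℝ) (ht : 0 < t) :
    ∫⁻ x, ENNReal.ofReal (‖x - z‖ ^ s) * G (z + t • (x - z)) =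
      ENNReal.ofReal (t ^ (-s - n)) * ∫⁻ y, ENNReal.ofReal (‖y - z‖ ^ s) * G y := by
  let H : EuclideanSpace ℝ (Fin n) → ℝ≥0∞ := fun u => ENNReal.ofReal (‖u‖ ^ s) * G (z + u)
  have hH : Measurable H := by unfold H; fun_prop
  have h1 : ∫⁻ y, ENNReal.ofReal (‖y - z‖ ^ s) * G y = ∫⁻ u, H u := by
    rw [← lintegral_sub_right_eq_self H z]; simp [H]
  have h2 : ∫⁻ x, ENNReal.ofReal (‖x - z‖ ^ s) * G (z + t • (x - z)) =
      ∫⁻ u, ENNReal.ofReal (t ^ (-s)) * H (t • u) := by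
    rw [← lintegral_sub_right_eq_self (fun u => ENNReal.ofReal (t ^ (-s)) * H (t • u)) z]
    refine lintegral_congr fun x => ?_
    simp only [H]
    rw [← mul_assoc, ← ENNReal.ofReal_mul (by positivity), norm_smul, Real.norm_of_nonneg ht.le,
      Real.mul_rpow ht.le (norm_nonneg _), ← mul_assoc, ← Real.rpow_add ht]
    simp
  rw [h1, h2, lintegral_const_mul _ (by fun_prop), dil H hH t ht, ← mul_assoc,
    ← ENNReal.ofReal_mul (by positivity), ← Real.rpow_add ht]
  rfl

lemma cov_int {n : ℕ} (s a : ℝ) (G : EuclideanSpace ℝ (Fin n) → ℝ≥0∞) (hG : Measurable G)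
    (z : EuclideanSpace ℝ (Fin n)) :
    ∫⁻ x, ENNReal.ofReal (‖x - z‖ ^ s) * ∫⁻ t in Set.Ioo (0:ℝ) 1,
        ENNReal.ofReal (t ^ a) * G (z + t • (x - z)) =
      (∫⁻ t in Set.Ioo (0:ℝ) 1, ENNReal.ofReal (t ^ (a - s - n))) *
        ∫⁻ y, ENNReal.ofReal (‖y - z‖ ^ s) * G y := by
  calc _ = ∫⁻ x, ∫⁻ t in Set.Ioo (0:ℝ) 1,
        ENNReal.ofReal (‖x - z‖ ^ s) * (ENNReal.ofReal (t ^ a) * G (z + t • (x - z))) := by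
        refine lintegral_congr fun x => ?_
        rw [lintegral_const_mul _ (by fun_prop)]
    _ = ∫⁻ t in Set.Ioo (0:ℝ) 1, ∫⁻ x,
        ENNReal.ofReal (‖x - z‖ ^ s) * (ENNReal.ofReal (t ^ a) * G (z + t • (x - z))) := by
        rw [lintegral_lintegral_swap]
        exact (by fun_prop : Measurable _).aemeasurable
    _ = ∫⁻ t in Set.Ioo (0:ℝ) 1, ENNReal.ofReal (t ^ (a - s - n)) *
        ∫⁻ y, ENNReal.ofReal (‖y - z‖ ^ s) * G y := by
        refine setLIntegral_congr_fun measurableSet_Ioo (fun t ht => ?_)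
        simp only [mul_left_comm _ (ENNReal.ofReal (t ^ a))]
        rw [lintegral_const_mul _ (by fun_prop), cov s G hG z t ht.1, ← mul_assoc,
          ← ENNReal.ofReal_mul (by have := ht.1; positivity), ← Real.rpow_add ht.1]
        have e : a + (-s - n) = a - s - n := by ring
        rw [e]
    _ = _ := by rw [lintegral_mul_const _ (by fun_prop)]

lemma ker_pt {n : ℕ} (m : ℝ) (hm : 1 < m) (y z : EuclideanSpace ℝ (Fin n))
    (hz : z ∈ Metric.ball (0 : EuclideanSpace ℝ (Fin n)) 1) :
    ENNReal.ofReal (‖y - z‖ ^ (2 - 2 * m)) ≤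
      ENNReal.ofReal (6 ^ (m - 1) * (1 + ‖y‖ ^ 2) ^ (1 - m)) *
        (1 + (Metric.ball (0 : EuclideanSpace ℝ (Fin n)) 1).indicator
          (fun u => ENNReal.ofReal (‖u‖ ^ (2 - 2 * m))) (z - y)) := by
  have hz1 : ‖z‖ < 1 := by simpa using hz
  have hy : ‖y‖ ≤ ‖y - z‖ + ‖z‖ := by simpa using norm_add_le (y - z) z
  have h0 := norm_nonneg y
  have h0' := norm_nonneg (y - z)
  by_cases hr : ‖y - z‖ < 1
  · have hmem : z - y ∈ Metric.ball (0 : EuclideanSpace ℝ (Fin n)) 1 := by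
      simpa [norm_sub_rev] using hr
    rw [Set.indicator_of_mem hmem, norm_sub_rev z y]
    have h1 : (1:ℝ≥0∞) ≤ ENNReal.ofReal (6 ^ (m - 1) * (1 + ‖y‖ ^ 2) ^ (1 - m)) := by
      rw [← ENNReal.ofReal_one]
      apply ENNReal.ofReal_le_ofReal
      have h2 : (1 + ‖y‖ ^ 2) ^ (m - 1) ≤ 6 ^ (m - 1) :=
        Real.rpow_le_rpow (by positivity) (by nlinarith) (by linarith)
      have : 1 - m = -(m - 1) := by ring
      rw [this, Real.rpow_neg (by positivity), ← div_eq_mul_inv, le_div_iff₀ (by positivity)]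
      linarith
    calc _ = 1 * (ENNReal.ofReal (‖y - z‖ ^ (2 - 2 * m))) := by rw [one_mul]
      _ ≤ _ := mul_le_mul' h1 le_add_self
  · push Not at hr
    refine le_trans ?_ (mul_le_mul' le_rfl (le_add_right (le_refl (1:ℝ≥0∞))))
    rw [mul_one]
    apply ENNReal.ofReal_le_ofReal
    have h2 : (1 + ‖y‖ ^ 2) ^ (m - 1) ≤ (6 * ‖y - z‖ ^ 2) ^ (m - 1) :=
        Real.rpow_le_rpow (by positivity) (by nlinarith) (by linarith)
    have e1 : 1 - m = -(m - 1) := by ring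
    have e2 : 2 - 2 * m = -(2 * (m - 1)) := by ring
    have hp : 0 < ‖y - z‖ := by linarith
    rw [e1, e2, Real.rpow_neg (by positivity), Real.rpow_neg (by positivity), ← div_eq_mul_inv,
      le_div_iff₀ (by positivity), inv_mul_le_iff₀ (by positivity)]
    rw [Real.mul_rpow (by positivity) (by positivity), ← Real.rpow_natCast_mul (by positivity)] at h2
    push_cast at h2
    linarith

lemma ker_bound {n : ℕ} (m : ℝ) (hm : 1 < m) (y : EuclideanSpace ℝ (Fin n)) :
    ∫⁻ z in Metric.ball (0 : EuclideanSpace ℝ (Fin n)) 1, ENNReal.ofReal (‖y - z‖ ^ (2 - 2 * m)) ≤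
      ENNReal.ofReal (6 ^ (m - 1)) * (volume (Metric.ball (0 : EuclideanSpace ℝ (Fin n)) 1) +
        ∫⁻ u in Metric.ball (0 : EuclideanSpace ℝ (Fin n)) 1, ENNReal.ofReal (‖u‖ ^ (2 - 2 * m))) *
      ENNReal.ofReal ((1 + ‖y‖ ^ 2) ^ (1 - m)) := by
  have hmeas : Measurable (fun u : EuclideanSpace ℝ (Fin n) =>
      (Metric.ball (0 : EuclideanSpace ℝ (Fin n)) 1).indicator
          (fun u => ENNReal.ofReal (‖u‖ ^ (2 - 2 * m))) u) :=
    Measurable.indicator (by fun_prop) measurableSet_ball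
  refine (setLIntegral_mono' measurableSet_ball (fun z hz => ker_pt m hm y z hz)).trans ?_
  rw [lintegral_const_mul _ (by fun_prop), ENNReal.ofReal_mul (by positivity), mul_right_comm]
  gcongr
  rw [lintegral_add_left measurable_const]
  refine add_le_add ?_ ?_
  · simp
  · refine (setLIntegral_le_lintegral _ _).trans ?_
    rw [lintegral_sub_right_eq_self (fun u => (Metric.ball (0 : EuclideanSpace ℝ (Fin n)) 1).indicator
          (fun u => ENNReal.ofReal (‖u‖ ^ (2 - 2 * m))) u) y, lintegral_indicator measurableSet_ball]

lemma wt_pt {n : ℕ} (m : ℝ) (hm : 1 < m) (x z : EuclideanSpace ℝ (Fin n))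
    (hz : z ∈ Metric.ball (0 : EuclideanSpace ℝ (Fin n)) 1) :
    ENNReal.ofReal ((1 + ‖x‖ ^ 2) ^ (-m)) * ‖x - z‖ₑ ^ 2 ≤
      ENNReal.ofReal (3 ^ m) * ENNReal.ofReal (‖x - z‖ ^ (2 - 2 * m)) := by
  have hz1 : ‖z‖ < 1 := by simpa using hz
  have hy : ‖x - z‖ ≤ ‖x‖ + ‖z‖ := norm_sub_le x z
  have h0 := norm_nonneg x
  rw [← ofReal_norm, ← ENNReal.ofReal_pow (by positivity), ← ENNReal.ofReal_mul (by positivity),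
    ← ENNReal.ofReal_mul (by positivity)]
  apply ENNReal.ofReal_le_ofReal
  rcases (norm_nonneg (x - z)).eq_or_lt with h | h
  · rw [← h]; simp; positivity
  · have h2 : (‖x - z‖ ^ 2) ^ m ≤ (3 * (1 + ‖x‖ ^ 2)) ^ m :=
      Real.rpow_le_rpow (by positivity) (by nlinarith [sq_nonneg (‖x‖ - 1)]) (by linarith)
    rw [Real.mul_rpow (by positivity) (by positivity), ← Real.rpow_natCast_mul (by positivity)] at h2
    push_cast at h2
    rw [Real.rpow_sub h, Real.rpow_neg (by positivity), Real.rpow_two, ← mul_div_assoc,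
      le_div_iff₀ (by positivity), mul_assoc, inv_mul_le_iff₀ (by positivity)]
    have := sq_nonneg ‖x - z‖
    nlinarith

/-- the weighted Poincaré inequality -/
lemma poincare {n : ℕ} (hn : 2 ≤ n) (m : ℝ)
    (hm : m ∈ Set.Ioo ((n : ℝ) / 2) ((n : ℝ) / 2 + 1)) :
    ∃ K : ℝ≥0∞, K < ∞ ∧ ∀ v : EuclideanSpace ℝ (Fin n) → ℝ, ContDiff ℝ 1 v →
      ∫⁻ z in Metric.ball (0 : EuclideanSpace ℝ (Fin n)) 1, ∫⁻ x,
        ENNReal.ofReal ((1 + ‖x‖ ^ 2) ^ (-m)) * ‖v x - v z‖ₑ ^ 2 ≤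
      K * ∫⁻ y, ENNReal.ofReal ((1 + ‖y‖ ^ 2) ^ (1 - m)) * ‖fderiv ℝ v y‖ₑ ^ 2 := by
  obtain ⟨hm1, hm2⟩ := hm
  have hn' : (2:ℝ) ≤ n := by exact_mod_cast hn
  have h1m : 1 < m := by linarith
  set a : ℝ := n / 2 + 1 - m with ha
  set A := ∫⁻ t in Set.Ioo (0:ℝ) 1, ENNReal.ofReal (t ^ (-a)) with hA
  set B := ∫⁻ t in Set.Ioo (0:ℝ) 1, ENNReal.ofReal (t ^ (a - (2 - 2 * m) - n)) with hB
  set D := ENNReal.ofReal (6 ^ (m - 1)) * (volume (Metric.ball (0 : EuclideanSpace ℝ (Fin n)) 1) +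
        ∫⁻ u in Metric.ball (0 : EuclideanSpace ℝ (Fin n)) 1, ENNReal.ofReal (‖u‖ ^ (2 - 2 * m)))
    with hD
  have hAf : A < ∞ := rpow_fin _ (by linarith)
  have hBf : B < ∞ := rpow_fin _ (by linarith)
  have hDf : D < ∞ := ENNReal.mul_lt_top ENNReal.ofReal_lt_top
    (ENNReal.add_lt_top.2 ⟨measure_ball_lt_top, ker_fin hn _ (by linarith)⟩)
  refine ⟨A * ENNReal.ofReal (3 ^ m) * B * D, ?_, ?_⟩
  · exact ENNReal.mul_lt_top (ENNReal.mul_lt_top (ENNReal.mul_lt_top hAf ENNReal.ofReal_lt_top) hBf) hDf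
  intro v hv
  have hG : Measurable (fun y => ‖fderiv ℝ v y‖ₑ ^ 2) :=
    ((hv.continuous_fderiv one_ne_zero).enorm.measurable).pow_const 2
  set G := (fun y => ‖fderiv ℝ v y‖ₑ ^ 2) with hGdef
  have step : ∀ z ∈ Metric.ball (0 : EuclideanSpace ℝ (Fin n)) 1,
      ∫⁻ x, ENNReal.ofReal ((1 + ‖x‖ ^ 2) ^ (-m)) * ‖v x - v z‖ₑ ^ 2 ≤
      A * ENNReal.ofReal (3 ^ m) * B * ∫⁻ y, ENNReal.ofReal (‖y - z‖ ^ (2 - 2 * m)) * G y := by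
    intro z hz
    rw [mul_assoc _ B, ← cov_int (2 - 2 * m) a G hG z, ← lintegral_const_mul' _ _
      (ENNReal.mul_lt_top hAf ENNReal.ofReal_lt_top).ne]
    refine lintegral_mono fun x => ?_
    calc _ ≤ ENNReal.ofReal ((1 + ‖x‖ ^ 2) ^ (-m)) * (A * (‖x - z‖ₑ ^ 2 *
          ∫⁻ t in Set.Ioo (0:ℝ) 1, ENNReal.ofReal (t ^ a) * G (z + t • (x - z)))) :=
          mul_le_mul' le_rfl (seg_bound v hv a x z)
      _ = A * (ENNReal.ofReal ((1 + ‖x‖ ^ 2) ^ (-m)) * ‖x - z‖ₑ ^ 2) *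
          ∫⁻ t in Set.Ioo (0:ℝ) 1, ENNReal.ofReal (t ^ a) * G (z + t • (x - z)) := by ring
      _ ≤ A * (ENNReal.ofReal (3 ^ m) * ENNReal.ofReal (‖x - z‖ ^ (2 - 2 * m))) *
          ∫⁻ t in Set.Ioo (0:ℝ) 1, ENNReal.ofReal (t ^ a) * G (z + t • (x - z)) := by
          refine mul_le_mul' (mul_le_mul' le_rfl ?_) le_rfl
          exact wt_pt m h1m x z hz
      _ = _ := by ring
  refine (setLIntegral_mono' measurableSet_ball step).trans ?_
  rw [lintegral_const_mul' _ _ (ENNReal.mul_lt_top (ENNReal.mul_lt_top hAf ENNReal.ofReal_lt_top) hBf).ne,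
    mul_assoc _ D]
  gcongr
  rw [lintegral_lintegral_swap (by exact (by fun_prop : Measurable _).aemeasurable),
    ← lintegral_const_mul' _ _ hDf.ne]
  refine lintegral_mono fun y => ?_
  simp only
  rw [lintegral_mul_const _ (by fun_prop), ← mul_assoc]
  gcongr
  exact ker_bound m h1m y

lemma riesz_range {V H : Type*} [AddCommGroup V] [Module ℝ V] [NormedAddCommGroup H]
    [InnerProductSpace ℝ H] [CompleteSpace H] (T : V →ₗ[ℝ] H) (l : V →ₗ[ℝ] ℝ) (M : ℝ)
    (hM : 0 ≤ M) (h : ∀ v, |l v| ≤ M * ‖T v‖) :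
    ∃ w : H, (∀ v, ⟪w, T v⟫ = l v) ∧ ‖w‖ ≤ M := by
  obtain ⟨s, hs⟩ := T.rangeRestrict.exists_rightInverse_of_surjective T.range_rangeRestrict
  have hs' : ∀ y : LinearMap.range T, T (s y) = y := fun y => by
    have := congrArg Subtype.val (LinearMap.congr_fun hs y)
    simpa using this
  let φ : StrongDual ℝ (LinearMap.range T) := (l.comp s).mkContinuous M (fun y => by
    have := h (s y)
    rw [hs'] at this
    simpa using this)
  obtain ⟨ψ, hψ, hn⟩ := _root_.exists_extension_norm_eq (LinearMap.range T) φ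
  refine ⟨(InnerProductSpace.toDual ℝ H).symm ψ, fun v => ?_, ?_⟩
  · rw [InnerProductSpace.toDual_symm_apply]
    have h1 := hψ ⟨T v, LinearMap.mem_range_self T v⟩
    simp only at h1
    rw [h1]
    change l (s _) = l v
    have h2 := h (s ⟨T v, LinearMap.mem_range_self T v⟩ - v)
    rw [map_sub, map_sub, hs'] at h2
    simp only [sub_self, norm_zero, mul_zero] at h2
    exact sub_eq_zero.1 (abs_eq_zero.1 (le_antisymm h2 (abs_nonneg _)))
  · rw [LinearIsometryEquiv.norm_map, hn]
    exact LinearMap.mkContinuous_norm_le _ hM _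

lemma fv_bound {n : ℕ} (m : ℝ) (f v : EuclideanSpace ℝ (Fin n) → ℝ) (hf : Measurable f)
    (hfi : Integrable f) (hf0 : (∫ x, f x) = 0) (hv : Continuous v)
    (hfv : Integrable (fun x => f x * v x)) (z : EuclideanSpace ℝ (Fin n)) :
    ‖∫ x, f x * v x‖ₑ ^ 2 ≤ (∫⁻ y, ENNReal.ofReal ((1 + ‖y‖ ^ 2) ^ m * f y ^ 2)) *
      ∫⁻ x, ENNReal.ofReal ((1 + ‖x‖ ^ 2) ^ (-m)) * ‖v x - v z‖ₑ ^ 2 := by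
  have h1 : ∫ x, f x * v x = ∫ x, f x * (v x - v z) := by
    simp only [mul_sub]
    rw [integral_sub hfv (hfi.mul_const _), integral_mul_const, hf0]
    simp
  have hsq : ∀ (b : ℝ) (x : EuclideanSpace ℝ (Fin n)),
      ENNReal.ofReal ((1 + ‖x‖ ^ 2) ^ (b/2)) ^ 2 = ENNReal.ofReal ((1 + ‖x‖ ^ 2) ^ b) := by
    intro b x
    rw [← ENNReal.ofReal_pow (by positivity), ← Real.rpow_natCast,
      ← Real.rpow_mul (by positivity)]
    norm_num
  have h2 : ‖∫ x, f x * v x‖ₑ ≤ ∫⁻ x, (ENNReal.ofReal ((1 + ‖x‖ ^ 2) ^ (m/2)) * ‖f x‖ₑ) *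
      (ENNReal.ofReal ((1 + ‖x‖ ^ 2) ^ (-m/2)) * ‖v x - v z‖ₑ) := by
    rw [h1]
    refine (enorm_integral_le_lintegral_enorm _).trans (lintegral_mono fun x => ?_)
    rw [mul_mul_mul_comm, ← ENNReal.ofReal_mul (by positivity), ← Real.rpow_add (by positivity)]
    have : m / 2 + -m / 2 = 0 := by ring
    rw [this, Real.rpow_zero, ENNReal.ofReal_one, one_mul, enorm_mul]
  have hvm := hv.measurable
  refine (pow_le_pow_left' h2 2).trans ((cs_sq _ _ _ (by exact (by fun_prop : Measurable _).aemeasurable)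
    (by exact (by fun_prop : Measurable _).aemeasurable)).trans (le_of_eq ?_))
  congr 1
  · refine lintegral_congr fun x => ?_
    rw [mul_pow, hsq, ENNReal.ofReal_mul (by positivity), ← ofReal_norm,
      ← ENNReal.ofReal_pow (by positivity), Real.norm_eq_abs, sq_abs]
  · refine lintegral_congr fun x => ?_
    rw [mul_pow, hsq]

lemma enorm_gradient {n : ℕ} (v : EuclideanSpace ℝ (Fin n) → ℝ) (x : EuclideanSpace ℝ (Fin n)) :
    ‖gradient v x‖ₑ = ‖fderiv ℝ v x‖ₑ := by
  rw [← ofReal_norm, ← ofReal_norm, gradient, LinearIsometryEquiv.norm_map]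

/-- test functions -/
def TestSp (n : ℕ) : Submodule ℝ (EuclideanSpace ℝ (Fin n) → ℝ) where
  carrier := {v | ContDiff ℝ (⊤ : ℕ∞) v ∧ HasCompactSupport v}
  add_mem' := fun ha hb => ⟨ha.1.add hb.1, ha.2.add hb.2⟩
  zero_mem' := ⟨contDiff_const, HasCompactSupport.zero⟩
  smul_mem' := fun c _ ha => ⟨contDiff_const.smul ha.1, ha.2.smul_left (f := fun _ => c)⟩

/-- weighted gradient -/
noncomputable def wgrad {n : ℕ} (m : ℝ) (v : EuclideanSpace ℝ (Fin n) → ℝ)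
    (x : EuclideanSpace ℝ (Fin n)) : EuclideanSpace ℝ (Fin n) :=
  ((1 + ‖x‖ ^ 2) ^ ((1 - m) / 2) : ℝ) • gradient v x

lemma wcont {n : ℕ} (b : ℝ) :
    Continuous (fun x : EuclideanSpace ℝ (Fin n) => ((1 + ‖x‖ ^ 2) ^ b : ℝ)) :=
  Continuous.rpow_const (by fun_prop) (fun x => Or.inl (by positivity))

lemma wgrad_memLp {n : ℕ} (m : ℝ) (v : TestSp n) : MemLp (wgrad m v.1) 2 volume := by
  have h1 : Continuous (gradient v.1) :=
    (InnerProductSpace.toDual ℝ (EuclideanSpace ℝ (Fin n))).symm.continuous.comp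
      (v.2.1.continuous_fderiv (by simp))
  have h2 : HasCompactSupport (gradient v.1) := by
    have := v.2.2.fderiv (𝕜 := ℝ)
    exact this.comp_left (g := (InnerProductSpace.toDual ℝ (EuclideanSpace ℝ (Fin n))).symm) (map_zero _)
  exact ((wcont _).smul h1).memLp_of_hasCompactSupport h2.smul_left

/-- weighted gradient as a linear map -/
noncomputable def TW (n : ℕ) (m : ℝ) :
    TestSp n →ₗ[ℝ] Lp (EuclideanSpace ℝ (Fin n)) 2 (volume : Measure (EuclideanSpace ℝ (Fin n))) where
  toFun v := (wgrad_memLp m v).toLp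
  map_add' v w := by
    rw [← MemLp.toLp_add]
    congr 1
    funext x
    have hv := v.2.1.differentiable (by simp) x
    have hw := w.2.1.differentiable (by simp) x
    simp [wgrad, gradient, fderiv_add hv hw]
  map_smul' c v := by
    rw [RingHom.id_apply, ← MemLp.toLp_const_smul]
    congr 1
    funext x
    have hv := v.2.1.differentiable (by simp) x
    simp only [wgrad, gradient, Submodule.coe_smul, Pi.smul_apply]
    rw [fderiv_const_smul hv, map_smul, smul_comm]

lemma sq_enorm_lp {n : ℕ} (h : EuclideanSpace ℝ (Fin n) → EuclideanSpace ℝ (Fin n)) :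
    eLpNorm h 2 volume ^ 2 = ∫⁻ x, ‖h x‖ₑ ^ 2 := by
  rw [eLpNorm_eq_lintegral_rpow_enorm_toReal two_ne_zero ENNReal.ofNat_ne_top,
    ← ENNReal.rpow_natCast, ← ENNReal.rpow_mul]
  norm_num

lemma TW_norm (n : ℕ) (m : ℝ) (v : TestSp n) :
    ‖TW n m v‖ₑ ^ 2 = ∫⁻ y, ENNReal.ofReal ((1 + ‖y‖ ^ 2) ^ (1 - m)) * ‖fderiv ℝ v.1 y‖ₑ ^ 2 := by
  change ‖(wgrad_memLp m v).toLp‖ₑ ^ 2 = _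
  rw [Lp.enorm_toLp, sq_enorm_lp]
  refine lintegral_congr fun x => ?_
  rw [wgrad, enorm_smul, mul_pow, enorm_gradient, Real.enorm_of_nonneg (by positivity),
    ← ENNReal.ofReal_pow (by positivity), ← Real.rpow_mul_natCast (by positivity)]
  congr 4
  push_cast; ring

theorem divergence_equation_weighted
    {n : ℕ} (hn : 2 ≤ n) (m : ℝ)
    (hm : m ∈ Set.Ioo ((n : ℝ) / 2) ((n : ℝ) / 2 + 1)) :
    ∃ C > (0 : ℝ), ∀ f : EuclideanSpace ℝ (Fin n) → ℝ, Measurable f → Integrable f →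
      (∫⁻ y, ENNReal.ofReal ((1 + ‖y‖ ^ 2) ^ m * f y ^ 2)) < ∞ →
      (∫ x, f x) = 0 →
      ∃ g : EuclideanSpace ℝ (Fin n) → EuclideanSpace ℝ (Fin n),
        (∀ v : EuclideanSpace ℝ (Fin n) → ℝ, ContDiff ℝ (⊤ : ℕ∞) v →
          HasCompactSupport v → ∫ x, ⟪g x, gradient v x⟫ = -∫ x, f x * v x) ∧
        (∫⁻ y, ENNReal.ofReal ((1 + ‖y‖ ^ 2) ^ (m - 1) * ‖g y‖ ^ 2))
          ≤ ENNReal.ofReal (C ^ 2) *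
            ∫⁻ y, ENNReal.ofReal ((1 + ‖y‖ ^ 2) ^ m * f y ^ 2) := by
  obtain ⟨K, hK, hP⟩ := poincare hn m hm
  set β := volume (Metric.ball (0 : EuclideanSpace ℝ (Fin n)) 1) with hβ
  have hβ0 : β ≠ 0 := (Metric.measure_ball_pos _ _ one_pos).ne'
  have hβt : β ≠ ∞ := measure_ball_lt_top.ne
  have hL : K / β ≠ ∞ := ENNReal.div_ne_top hK.ne hβ0
  refine ⟨Real.sqrt (K / β).toReal + 1, by positivity, ?_⟩
  intro f hf hfi hF hf0
  set F := ∫⁻ y, ENNReal.ofReal ((1 + ‖y‖ ^ 2) ^ m * f y ^ 2) with hFdef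
  have hfv : ∀ v : TestSp n, Integrable (fun x => f x * v.1 x) := by
    intro v
    obtain ⟨c, hc⟩ := v.2.2.exists_bound_of_continuous v.2.1.continuous
    exact hfi.mul_bdd (c := c) v.2.1.continuous.aestronglyMeasurable (Filter.Eventually.of_forall hc)
  let l : TestSp n →ₗ[ℝ] ℝ :=
    { toFun := fun v => -∫ x, f x * v.1 x
      map_add' := fun v w => by
        simp only [Submodule.coe_add, Pi.add_apply, mul_add]
        rw [integral_add (hfv v) (hfv w)]; ring
      map_smul' := fun c v => by
        simp only [Submodule.coe_smul, Pi.smul_apply, smul_eq_mul, mul_left_comm _ c, RingHom.id_apply]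
        rw [integral_const_mul]; ring }
  have hFL : F * (K / β) ≠ ∞ := ENNReal.mul_ne_top hF.ne hL
  have key : ∀ v : TestSp n, ‖∫ x, f x * v.1 x‖ₑ ^ 2 ≤ F * (K / β) * ‖TW n m v‖ₑ ^ 2 := by
    intro v
    have h1 : ∫⁻ z in Metric.ball (0 : EuclideanSpace ℝ (Fin n)) 1, ‖∫ x, f x * v.1 x‖ₑ ^ 2 ≤
        ∫⁻ z in Metric.ball (0 : EuclideanSpace ℝ (Fin n)) 1, F *
          ∫⁻ x, ENNReal.ofReal ((1 + ‖x‖ ^ 2) ^ (-m)) * ‖v.1 x - v.1 z‖ₑ ^ 2 :=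
      lintegral_mono fun z => fv_bound m f v.1 hf hfi hf0 v.2.1.continuous (hfv v) z
    rw [lintegral_const_mul' _ _ hF.ne, setLIntegral_const] at h1
    have h2 := h1.trans (mul_le_mul' le_rfl (hP v.1 (v.2.1.of_le (by simp))))
    rw [← TW_norm, ← hβ] at h2
    have h3 := (ENNReal.le_div_iff_mul_le (Or.inl hβ0) (Or.inl hβt)).2 h2
    refine h3.trans (le_of_eq ?_)
    simp only [div_eq_mul_inv]
    ring
  have hb : ∀ v, |l v| ≤ Real.sqrt (F * (K / β)).toReal * ‖TW n m v‖ := by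
    intro v
    have h1 := ENNReal.toReal_mono (ENNReal.mul_ne_top hFL (by simp)) (key v)
    rw [ENNReal.toReal_mul, ENNReal.toReal_pow, ENNReal.toReal_pow, toReal_enorm, toReal_enorm] at h1
    have h2 : |l v| = ‖∫ x, f x * v.1 x‖ := by
      change |-∫ x, f x * v.1 x| = _
      rw [abs_neg, Real.norm_eq_abs]
    rw [h2]
    refine abs_le_of_sq_le_sq' ?_ (by positivity) |>.2
    rw [mul_pow, Real.sq_sqrt ENNReal.toReal_nonneg]
    exact h1
  obtain ⟨w, hw, hwn⟩ := riesz_range (TW n m) l _ (Real.sqrt_nonneg _) hb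
  refine ⟨fun x => ((1 + ‖x‖ ^ 2) ^ ((1 - m) / 2) : ℝ) • w x, ?_, ?_⟩
  · intro v hv hvc
    have h1 := hw ⟨v, hv, hvc⟩
    change _ = -∫ x, f x * v x at h1
    rw [← h1, L2.inner_def]
    refine integral_congr_ae ?_
    filter_upwards [(wgrad_memLp m ⟨v, hv, hvc⟩).coeFn_toLp] with x hx
    change _ = ⟪w x, (MemLp.toLp _ (wgrad_memLp m ⟨v, hv, hvc⟩) : EuclideanSpace ℝ (Fin n) → EuclideanSpace ℝ (Fin n)) x⟫
    rw [hx, wgrad, real_inner_smul_left, real_inner_smul_right]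
  · have h1 : ∫⁻ y, ENNReal.ofReal ((1 + ‖y‖ ^ 2) ^ (m - 1) *
        ‖((1 + ‖y‖ ^ 2) ^ ((1 - m) / 2) : ℝ) • w y‖ ^ 2) = ‖w‖ₑ ^ 2 := by
      rw [Lp.enorm_def, sq_enorm_lp]
      refine lintegral_congr fun x => ?_
      rw [← ofReal_norm, ← ENNReal.ofReal_pow (norm_nonneg _), norm_smul,
        Real.norm_of_nonneg (by positivity), mul_pow, ← Real.rpow_mul_natCast (by positivity),
        ← mul_assoc, ← Real.rpow_add (by positivity)]
      have : m - 1 + (1 - m) / 2 * ((2:ℕ):ℝ) = 0 := by push_cast; ring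
      rw [this, Real.rpow_zero, one_mul]
    rw [h1]
    have h2 : ‖w‖ₑ ^ 2 ≤ F * (K / β) := by
      rw [← ofReal_norm, ← ENNReal.ofReal_pow (norm_nonneg _)]
      apply ENNReal.ofReal_le_of_le_toReal
      calc ‖w‖ ^ 2 ≤ _ := pow_le_pow_left₀ (norm_nonneg _) hwn 2
        _ = _ := Real.sq_sqrt ENNReal.toReal_nonneg
    refine h2.trans ?_
    rw [mul_comm]
    gcongr
    rw [ENNReal.le_ofReal_iff_toReal_le hL (by positivity)]
    have h3 := Real.sq_sqrt (ENNReal.toReal_nonneg (a := K / β))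
    have h4 := Real.sqrt_nonneg (K / β).toReal
    nlinarith
end

section
/- Let n ≥ 1 and let ζ, ξ ∈ ℝⁿ with ζ ≠ 0 and ⟨ζ, ξ⟩ = 0. Define the symmetric n×n matrix M by M_{ij} = ( |ξ|²/|ζ|⁴ ) ζ_i ζ_j − ( 1/|ζ|² ) ( ζ_i ξ_j + ξ_i ζ_j ) + δ_{ij}. Then M ζ + M ξ = ζ. Moreover, if |ξ| ≤ κ |ζ| for some κ < 1, then M is positive definite. -/
open scoped RealInnerProductSpace

/-- **The matrix construction of Remark `principal`**. Let `ζ, ξ ∈ ℝⁿ` with `ζ ≠ 0` and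
`⟨ζ, ξ⟩ = 0`, and let `M` be the symmetric matrix
`M_{ij} = (|ξ|²/|ζ|⁴) ζᵢ ζⱼ - (1/|ζ|²)(ζᵢ ξⱼ + ξᵢ ζⱼ) + δ_{ij}`.
Then `M ζ + M ξ = ζ`, and `M` is positive definite whenever `|ξ| ≤ κ |ζ|` for some
`κ < 1`. -/
theorem matrix_construction_principal
    {n : ℕ} (hn : 1 ≤ n) (ζ ξ : EuclideanSpace ℝ (Fin n))
    (hζ : ζ ≠ 0) (horth : ⟪ζ, ξ⟫ = 0)
    (M : Matrix (Fin n) (Fin n) ℝ)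
    (hM : ∀ i j, M i j = (‖ξ‖ ^ 2 / ‖ζ‖ ^ 4) * (ζ i * ζ j)
        - (1 / ‖ζ‖ ^ 2) * (ζ i * ξ j + ξ i * ζ j)
        + (if i = j then 1 else 0)) :
    (M.mulVec (fun i => ζ i) + M.mulVec (fun i => ξ i) = fun i => ζ i) ∧
    (∀ κ : ℝ, κ < 1 → ‖ξ‖ ≤ κ * ‖ζ‖ → M.PosDef) := by
  have hZ : 0 < ‖ζ‖ ^ 2 := by positivity
  have hZs : ‖ζ‖ ^ 2 = ∑ j, ζ j * ζ j := by
    rw [EuclideanSpace.real_norm_sq_eq]; simp [sq]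
  have hXs : ‖ξ‖ ^ 2 = ∑ j, ξ j * ξ j := by
    rw [EuclideanSpace.real_norm_sq_eq]; simp [sq]
  have ho : ∑ j, ζ j * ξ j = 0 := by
    rw [← horth, PiLp.inner_apply]
    exact Finset.sum_congr rfl fun j _ => by simp [mul_comm]
  have h4 : ‖ζ‖ ^ 4 = (‖ζ‖ ^ 2) ^ 2 := by ring
  rw [h4] at hM
  generalize ‖ζ‖ ^ 2 = Z at *
  generalize ‖ξ‖ ^ 2 = X at *
  have key : ∀ (x : Fin n → ℝ) (i : Fin n), M.mulVec x i =
      X / Z ^ 2 * ζ i * (∑ j, ζ j * x j)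
      - 1 / Z * (ζ i * (∑ j, ξ j * x j) + ξ i * (∑ j, ζ j * x j)) + x i := by
    intro x i
    have h1 : x i = ∑ j, (if i = j then 1 else 0) * x j := by simp
    rw [h1]
    simp only [Matrix.mulVec, dotProduct, hM, Finset.mul_sum, ← Finset.sum_add_distrib,
      ← Finset.sum_sub_distrib]
    exact Finset.sum_congr rfl fun j _ => by ring
  have ho' : ∑ j, ξ j * ζ j = 0 := by
    rw [← ho]; exact Finset.sum_congr rfl fun j _ => by ring
  refine ⟨?_, ?_⟩
  · funext i
    rw [Pi.add_apply, key, key, ← hZs, ← hXs, ho, ho']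
    field_simp
    ring
  · intro κ _ _
    refine Matrix.PosDef.of_dotProduct_mulVec_pos ?_ ?_
    · ext i j
      rw [Matrix.conjTranspose_apply, star_trivial, hM, hM]
      simp only [eq_comm (a := i) (b := j)]
      ring
    · intro x hx
      obtain ⟨a, ha⟩ : ∃ a, a = ∑ j, ζ j * x j := ⟨_, rfl⟩
      obtain ⟨b, hb⟩ : ∃ b, b = ∑ j, ξ j * x j := ⟨_, rfl⟩
      have hQ : star x ⬝ᵥ M.mulVec x = ∑ i, (x i - a / Z * ξ i) ^ 2 := by
        have e1 : star x ⬝ᵥ M.mulVec x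
            = X / Z ^ 2 * a * a - 1 / Z * (b * a + a * b) + ∑ i, x i * x i := by
          have : star x ⬝ᵥ M.mulVec x = X / Z ^ 2 * a * (∑ j, ζ j * x j)
              - 1 / Z * (b * (∑ j, ζ j * x j) + a * (∑ j, ξ j * x j)) + ∑ i, x i * x i := by
            have key2 : ∀ i, M.mulVec x i =
                X / Z ^ 2 * ζ i * a - 1 / Z * (ζ i * b + ξ i * a) + x i := fun i => by
              rw [key, ← ha, ← hb]
            simp only [dotProduct, key2, star_trivial]
            simp only [Finset.mul_sum, ← Finset.sum_add_distrib, ← Finset.sum_sub_distrib]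
            exact Finset.sum_congr rfl fun j _ => by ring
          rw [this, ← ha, ← hb]
        have e2 : ∑ i, (x i - a / Z * ξ i) ^ 2
            = ∑ i, x i * x i - 2 * (a / Z) * b + (a / Z) ^ 2 * X := by
          rw [hb, hXs]
          simp only [Finset.mul_sum, ← Finset.sum_add_distrib, ← Finset.sum_sub_distrib]
          exact Finset.sum_congr rfl fun j _ => by ring
        rw [e1, e2]
        field_simp
        ring
      rw [hQ]
      refine lt_of_le_of_ne (Finset.sum_nonneg fun i _ => sq_nonneg _) fun h0 => hx ?_
      have hz := (Finset.sum_eq_zero_iff_of_nonneg (fun i _ => sq_nonneg _)).1 h0.symm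
      have hxi : ∀ i, x i = a / Z * ξ i := fun i => by
        have := pow_eq_zero_iff (two_ne_zero) |>.1 (hz i (Finset.mem_univ i))
        linarith
      have ha0 : a = 0 := by
        have : a = a / Z * ∑ j, ζ j * ξ j := by
          conv_lhs => rw [ha]
          rw [Finset.mul_sum]
          exact Finset.sum_congr rfl fun j _ => by rw [hxi j]; ring
        rw [this, ho, mul_zero]
      funext i
      rw [hxi i, ha0]; simp
end
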